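/- arXiv:1501.04024 — 2 statements merged into one kernel-verified Lean document; each statement's English description precedes it below -/
import Mathlib

section
/- Let ν be a complex number with ν(ν²−1)(ν²+1) ≠ 0. Define j₁ = (4/27)·(ν⁴−ν²+1)³/(ν⁴(ν²−1)²), j₂ = (1/108)·(ν⁴+14ν²+1)³/(ν²(ν²−1)⁴), and λ = ν²(1−ν²)²/(16(1+ν²)⁴). Then j₁ + j₂ = 2 − 23/(192λ) + 1/(1728λ²) and j₁·j₂ = (1 + 1/(144λ))³. That is, j₁ and j₂ are the two roots of the quadratic j² − σ(λ)j + π(λ) = 0, where σ(λ) and π(λ) are the σ and π invariants of the fibre of 𝒳₂ over λ = f(ν). -/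
/-- The fibrewise `j`-invariants `j₁`, `j₂` of `ℰ₁`, `ℰ₂` over `ν` are the two roots of
`j² − σ(λ)j + π(λ) = 0`, where `λ = f(ν)`: i.e. `j₁ + j₂ = σ(λ)` and `j₁·j₂ = π(λ)`. -/
theorem j1_j2_roots_of_sigma_pi (ν : ℂ) (hν : ν * (ν ^ 2 - 1) * (ν ^ 2 + 1) ≠ 0)
    (j₁ j₂ lam : ℂ)
    (hj₁ : j₁ = (4 / 27) * (ν ^ 4 - ν ^ 2 + 1) ^ 3 / (ν ^ 4 * (ν ^ 2 - 1) ^ 2))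
    (hj₂ : j₂ = (1 / 108) * (ν ^ 4 + 14 * ν ^ 2 + 1) ^ 3 / (ν ^ 2 * (ν ^ 2 - 1) ^ 4))
    (hlam : lam = ν ^ 2 * (1 - ν ^ 2) ^ 2 / (16 * (1 + ν ^ 2) ^ 4)) :
    j₁ + j₂ = 2 - 23 / (192 * lam) + 1 / (1728 * lam ^ 2) ∧
    j₁ * j₂ = (1 + 1 / (144 * lam)) ^ 3 := by
  have h0 : ν ≠ 0 := by
    rintro rfl
    simp at hν
  have h1 : ν ^ 2 - 1 ≠ 0 := by
    intro h
    simp [h] at hν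
  have h2 : 1 + ν ^ 2 ≠ 0 := by
    intro h
    apply hν
    rw [add_comm, h, mul_zero]
  have h3 : (1 - ν ^ 2) ^ 2 = (ν ^ 2 - 1) ^ 2 := by ring
  rw [h3] at hlam
  subst hj₁ hj₂ hlam
  generalize hb : ν ^ 2 - 1 = b at *
  generalize hc : 1 + ν ^ 2 = c at *
  constructor
  · field_simp
    subst hb hc
    ring
  · field_simp
    subst hb hc
    ring
end

section
/- Let ν, s, t, u be complex numbers with ν ≠ 1 and ν ≠ −1, and suppose u² = s(s−1)(s−((ν+1)/(ν−1))²)·t(t−1)(t−ν²). Set k = (ν−1)/(ν+1). Then (k³u)² = (k²s)(k²s−1)(k²s−((−ν+1)/(−ν−1))²)·t(t−1)(t−(−ν)²). That is, the map β: (ν,s,t,u) ↦ (−ν, ((ν−1)/(ν+1))²s, t, ((ν−1)/(ν+1))³u) maps the affine Kummer fibration 𝒴₂′ to itself, covering the involution ν ↦ −ν of the base. -/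
/-- The map `β : (ν,s,t,u) ↦ (−ν, k²s, t, k³u)` with `k = (ν−1)/(ν+1)` maps the affine
Kummer fibration `u² = s(s−1)(s−((ν+1)/(ν−1))²)·t(t−1)(t−ν²)` to itself, covering
`ν ↦ −ν` on the base. -/
theorem beta_preserves_Y2' (ν s t u : ℂ) (h1 : ν ≠ 1) (h2 : ν ≠ -1)
    (heq : u ^ 2 = s * (s - 1) * (s - ((ν + 1) / (ν - 1)) ^ 2) *
      (t * (t - 1) * (t - ν ^ 2)))
    (k : ℂ) (hk : k = (ν - 1) / (ν + 1)) :
    (k ^ 3 * u) ^ 2 =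
      (k ^ 2 * s) * (k ^ 2 * s - 1) * (k ^ 2 * s - ((-ν + 1) / (-ν - 1)) ^ 2) *
        (t * (t - 1) * (t - (-ν) ^ 2)) := by
  have a : ν - 1 ≠ 0 := sub_ne_zero.mpr h1
  have b : ν + 1 ≠ 0 := fun h => h2 (eq_neg_of_add_eq_zero_left h)
  have e1 : (-ν + 1) / (-ν - 1) = k := by
    rw [hk, ← neg_div_neg_eq]
    congr 1 <;> ring
  have e2 : k * ((ν + 1) / (ν - 1)) = 1 := by
    rw [hk]
    field_simp
  rw [e1, mul_pow, heq]
  generalize (ν + 1) / (ν - 1) = m at e2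
  have e3 : k ^ 2 * m ^ 2 = 1 := by rw [← mul_pow, e2, one_pow]
  linear_combination (-(k ^ 4 * s * (s - 1) * (t * (t - 1) * (t - ν ^ 2)))) * e3
end
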